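/- Let (T,(X_1,…,X_s)) be a tableau with substitution of dimension (n_1,…,n_m) over ℚ with distinguished columns q_1 = m−1, q_2 = m and n_{q_1} = n_{q_2} = n, and define g(T,τ) = sgn(τ) · bpf⁰_{T̃^τ}(X_{T̃^τ}) · tr(T^τ_cl) for τ ∈ S_n. Let τ ∈ S_n and let a, b ∈t T^τ with a ≠ b, φ(a) = φ(b), a' = b' ∈ {q_1,q_2}, and a'' = b'' ∉ {q_1,q_2}. Then g(T, ('a,'b) ∘ τ) = g(T, τ). -/

import Mathlib

open scoped BigOperators
set_option linter.unusedVariables false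

attribute [local instance] Classical.propDecidable

/-- The cells of a shape of dimension `n : ι → ℕ`: the column `i` has `n i` cells. -/
abbrev TabCell {ι : Type} (n : ι → ℕ) : Type := Σ i : ι, Fin (n i)

/-- A tableau with substitution `(T,(X_1,…,X_s))` of dimension `n : ι → ℕ` with entries
in `A`.  Cells are paired by the involution `mate` (each pair of cells is an arrow going
from the tail cell, where `isTail` holds, to the head cell); `lab` assigns to every
arrow (encoded via either of its two cells) its index `φ ∈ {1,…,s}`; `X j` is the matrix
assigned to the arrows with label `j`, which is an `n_{a''} × n_{a'}` matrix where
`colTail j = a''` and `colHead j = a'` are the tail and head columns of those arrows. -/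
structure TabSub (A : Type) [CommRing A] (ι : Type) [Fintype ι] [DecidableEq ι]
    (n : ι → ℕ) (s : ℕ) where
  mate : Equiv.Perm (TabCell n)
  isTail : TabCell n → Bool
  lab : TabCell n → Fin s
  colTail : Fin s → ι
  colHead : Fin s → ι
  X : ∀ j : Fin s, Matrix (Fin (n (colTail j))) (Fin (n (colHead j))) A
  mate_ne : ∀ c, mate c ≠ c
  mate_invol : ∀ c, mate (mate c) = c
  isTail_mate : ∀ c, isTail (mate c) = !isTail c
  lab_mate : ∀ c, lab (mate c) = lab c
  lab_surj : ∀ j : Fin s, ∃ c, isTail c = true ∧ lab c = j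
  colTail_eq : ∀ c, isTail c = true → colTail (lab c) = c.1
  colHead_eq : ∀ c, isTail c = true → colHead (lab c) = (mate c).1

namespace TabSub

variable {A : Type} [CommRing A] {ι : Type} [Fintype ι] [DecidableEq ι] {n : ι → ℕ} {s : ℕ}

/-- The entry of a (rectangular) matrix at a pair of natural number indices, extended
by zero outside the range. -/
def castEntry {a b : ι} (M : Matrix (Fin (n a)) (Fin (n b)) A) (i j : ℕ) : A :=
  if h : i < n a ∧ j < n b then M ⟨i, h.1⟩ ⟨j, h.2⟩ else 0

/-- The set of tail cells of a tableau; tail cells are in bijection with arrows. -/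
noncomputable def tails (T : TabSub A ι n s) : Finset (TabCell n) :=
  Finset.univ.filter fun c => T.isTail c = true

/-- `sgn(π_1)⋯sgn(π_m)` for a tuple of permutations of the columns. -/
def sgnT (π : ∀ i : ι, Equiv.Perm (Fin (n i))) : ℤ :=
  ∏ i, (Equiv.Perm.sign (π i) : ℤ)

/-- The factor `(X_{φ(a)})_{π_{a''}(''a), π_{a'}('a)}` contributed by the arrow with
tail cell `c`. -/
def entry (T : TabSub A ι n s) (π : ∀ i : ι, Equiv.Perm (Fin (n i))) (c : TabCell n) : A :=
  castEntry (T.X (T.lab c)) (π c.1 c.2 : Fin (n c.1)).1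
    ((π (T.mate c).1 (T.mate c).2 : Fin (n (T.mate c).1)).1)

/-- `bpf⁰_T(X_1,…,X_s)`: the sum over all tuples of permutations. -/
noncomputable def bpf0 (T : TabSub A ι n s) : A :=
  ∑ π : ∀ i : ι, Equiv.Perm (Fin (n i)), sgnT π • ∏ c ∈ T.tails, T.entry π c

/-- The condition on a tuple of permutations appearing in `bpf`: whenever
`φ(a) = φ(b)` and `''a < ''b` then `π_i(''a) < π_i(''b)`. -/
def SortedPi (T : TabSub A ι n s) (π : ∀ i : ι, Equiv.Perm (Fin (n i))) : Prop :=
  ∀ c ∈ T.tails, ∀ d ∈ T.tails, T.lab c = T.lab d → (c.2 : ℕ) < (d.2 : ℕ) →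
    ((π c.1 c.2 : Fin (n c.1)) : ℕ) < ((π d.1 d.2 : Fin (n d.1)) : ℕ)

/-- `bpf_T(X_1,…,X_s)`. -/
noncomputable def bpf (T : TabSub A ι n s) : A :=
  ∑ π ∈ Finset.univ.filter T.SortedPi, sgnT π • ∏ c ∈ T.tails, T.entry π c

/-- Conjugating a tableau with substitution by a column-preserving permutation of the
cells. -/
def permTab (T : TabSub A ι n s) (ρ : Equiv.Perm (TabCell n))
    (hρ : ∀ c, (ρ c).1 = c.1) : TabSub A ι n s where
  mate := (ρ.symm.trans T.mate).trans ρ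
  isTail c := T.isTail (ρ.symm c)
  lab c := T.lab (ρ.symm c)
  colTail := T.colTail
  colHead := T.colHead
  X := T.X
  mate_ne c h := by
    refine T.mate_ne (ρ.symm c) ?_
    simpa using congrArg ρ.symm h
  mate_invol c := by simp [T.mate_invol]
  isTail_mate c := by simpa using T.isTail_mate (ρ.symm c)
  lab_mate c := by simpa using T.lab_mate (ρ.symm c)
  lab_surj j := by
    obtain ⟨c, hc1, hc2⟩ := T.lab_surj j
    exact ⟨ρ c, by simpa using hc1, by simpa using hc2⟩
  colTail_eq c h := by
    have h1 := T.colTail_eq (ρ.symm c) h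
    have h2 : (ρ (ρ.symm c)).1 = (ρ.symm c).1 := hρ (ρ.symm c)
    simpa [h1] using h2.symm
  colHead_eq c h := by
    have h1 := T.colHead_eq (ρ.symm c) h
    have h2 := hρ (T.mate (ρ.symm c))
    simp only [Equiv.trans_apply]
    rw [h1, h2]

/-- The permutation of the cells permuting the cells of column `q` by `τ`. -/
def colPerm (n : ι → ℕ) (q : ι) (τ : Equiv.Perm (Fin (n q))) : Equiv.Perm (TabCell n) :=
  Equiv.sigmaCongrRight fun i =>
    if h : i = q then ((finCongr (congrArg n h)).permCongr.symm τ) else Equiv.refl _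

/-- The tableau `T^τ` obtained from `T` by permuting the cells of column `q` by `τ`. -/
def tw (T : TabSub A ι n s) (q : ι) (τ : Equiv.Perm (Fin (n q))) : TabSub A ι n s :=
  T.permTab (colPerm n q τ) (fun _ => rfl)

end TabSub

namespace TabSub

variable {A : Type} [CommRing A] {ι : Type} [Fintype ι] [DecidableEq ι] {n : ι → ℕ} {s : ℕ}

/-! ### Oriented arrows, paths, and the matrices they carry

An element `a ∈t T` (an arrow of `T` or the transpose of one) is encoded by a cell `c`:
the oriented arrow with tail cell `c` and head cell `T.mate c`.  If `c` is a tail cell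
this is the arrow itself, otherwise it is the transpose of an arrow. -/

/-- The letter `φ(a) ∈ M_T` of an oriented arrow: its label together with a flag telling
whether it is transposed. -/
def letter (T : TabSub A ι n s) (c : TabCell n) : Fin s × Bool := (T.lab c, !T.isTail c)

/-- The word `φ(a_1)⋯φ(a_r) ∈ M_T` of a word of oriented arrows. -/
def word (T : TabSub A ι n s) (l : List (TabCell n)) : List (Fin s × Bool) :=
  l.map T.letter

/-- The entries (as a function on natural number indices, extended by zero) of the
matrix `X_{φ(a)}` assigned to an oriented arrow: rows are indexed by its tail column,
columns by its head column; for a transposed arrow this is the transposed matrix. -/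
def matOf (T : TabSub A ι n s) (c : TabCell n) : ℕ → ℕ → A :=
  fun i j => if T.isTail c then castEntry (T.X (T.lab c)) i j else castEntry (T.X (T.lab c)) j i

/-- The product of a list of `ℕ×ℕ`-indexed matrices, all summations being over
`Finset.range B`. -/
def matListProd (B : ℕ) : List (ℕ → ℕ → A) → ℕ → ℕ → A
  | [] => fun i j => if i = j then 1 else 0
  | f :: fs => fun i j => ∑ p ∈ Finset.range B, f i p * matListProd B fs p j

/-- A bound exceeding the sizes of all matrices involved. -/
def dimBound (n : ι → ℕ) [Fintype ι] : ℕ := ∑ i, n i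

/-- The entries of the product matrix `X_{φ(a_1)}⋯X_{φ(a_r)}` of a word of oriented
arrows (the product being `0` if the sizes do not match). -/
def pathMat (T : TabSub A ι n s) (l : List (TabCell n)) : ℕ → ℕ → A :=
  matListProd (dimBound n) (l.map T.matOf)

/-- The trace of the matrix of a (closed) word of oriented arrows. -/
def pathTr (T : TabSub A ι n s) (l : List (TabCell n)) : A :=
  ∑ p ∈ Finset.range (dimBound n), T.pathMat l p p

/-- The entries of the matrix `X_u` of a word `u ∈ M_T` in the letters
`1,…,s,1ᵗ,…,sᵗ` (the product being `0` if the sizes do not match). -/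
def wordMat (T : TabSub A ι n s) (w : List (Fin s × Bool)) : ℕ → ℕ → A :=
  matListProd (dimBound n)
    (w.map fun p => fun i j =>
      if p.2 then castEntry (T.X p.1) j i else castEntry (T.X p.1) i j)

/-- `σ_k(X)`: the coefficient in the characteristic polynomial defined by
`det(λE − X) = λ^n − σ_1(X)λ^{n−1} + ⋯ + (−1)^n σ_n(X)`. -/
noncomputable def sigmaCoeff (N : ℕ) (M : Matrix (Fin N) (Fin N) A) (k : ℕ) : A :=
  (-1) ^ k * (Matrix.charpoly M).coeff (N - k)

/-- `σ_k(X_u)` for a word `u ∈ M_T`. -/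
noncomputable def wordSigma (T : TabSub A ι n s) (w : List (Fin s × Bool)) (k : ℕ) : A :=
  sigmaCoeff (dimBound n) (Matrix.of fun i j : Fin (dimBound n) => T.wordMat w i j) k

/-- Oriented arrows `a_1, a_2` are successive (with respect to the distinguished columns
`q_1, q_2`): `a_1', a_2'' ∈ {q_1,q_2}`, `a_1' ≠ a_2''` and `'a_1 = ''a_2`. -/
def Succ (T : TabSub A ι n s) (q1 q2 : ι) (c d : TabCell n) : Prop :=
  ((T.mate c).1 = q1 ∨ (T.mate c).1 = q2) ∧ (d.1 = q1 ∨ d.1 = q2) ∧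
    (T.mate c).1 ≠ d.1 ∧ ((T.mate c).2 : ℕ) = (d.2 : ℕ)

/-- A path in `T` with respect to the columns `q_1` and `q_2`: a (nonempty, repetition
free) word of oriented arrows in which consecutive arrows are successive. -/
def IsPath (T : TabSub A ι n s) (q1 q2 : ι) (l : List (TabCell n)) : Prop :=
  l ≠ [] ∧ l.Chain' (T.Succ q1 q2) ∧ l.Nodup

/-- An open path: a path passing through the columns `q_1,q_2` whose first tail and
last head lie outside `{q_1,q_2}`. -/
def IsOpenPath (T : TabSub A ι n s) (q1 q2 : ι) (l : List (TabCell n)) : Prop :=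
  T.IsPath q1 q2 l ∧ 2 ≤ l.length ∧ ∀ h : l ≠ [],
    ((l.head h).1 ≠ q1 ∧ (l.head h).1 ≠ q2) ∧
    ((T.mate (l.getLast h)).1 ≠ q1 ∧ (T.mate (l.getLast h)).1 ≠ q2)

/-- A closed path: a path whose last and first arrows are also successive. -/
def IsClosedPath (T : TabSub A ι n s) (q1 q2 : ι) (l : List (TabCell n)) : Prop :=
  T.IsPath q1 q2 l ∧ ∀ h : l ≠ [], T.Succ q1 q2 (l.getLast h) (l.head h)

/-- The transpose `aᵗ = a_rᵗ⋯a_1ᵗ` of a word of oriented arrows. -/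
def tp (T : TabSub A ι n s) (l : List (TabCell n)) : List (TabCell n) :=
  (l.map T.mate).reverse

/-- Equality of words of oriented arrows up to transposition (`=t`). -/
def eqT (T : TabSub A ι n s) (l l' : List (TabCell n)) : Prop :=
  l = l' ∨ l = T.tp l'

/-- Equality of words of oriented arrows up to cyclic permutation and transposition
(`=ct`). -/
def eqCT (T : TabSub A ι n s) (l l' : List (TabCell n)) : Prop :=
  l.IsRotated l' ∨ l.IsRotated (T.tp l')

/-- `R` is a set of representatives of the open paths of `T` (w.r.t. `q_1,q_2`) modulo
the `=t`-equivalence. -/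
def OpenReps (T : TabSub A ι n s) (q1 q2 : ι) (R : Finset (List (TabCell n))) : Prop :=
  (∀ l ∈ R, T.IsOpenPath q1 q2 l) ∧
  ∀ l, T.IsOpenPath q1 q2 l → ∃! l', l' ∈ R ∧ T.eqT l l'

/-- `R` is a set of representatives of the closed paths of `T` (w.r.t. `q_1,q_2`)
modulo the `=ct`-equivalence. -/
def ClosedReps (T : TabSub A ι n s) (q1 q2 : ι) (R : Finset (List (TabCell n))) : Prop :=
  (∀ l ∈ R, T.IsClosedPath q1 q2 l) ∧
  ∀ l, T.IsClosedPath q1 q2 l → ∃! l', l' ∈ R ∧ T.eqCT l l'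

/-- `tr(T_cl) = ∏_{a ∈ T_cl} tr(X_{φ(a)})` for a set `R` of representatives of the
closed paths. -/
noncomputable def trClosed (T : TabSub A ι n s) (R : Finset (List (TabCell n))) : A :=
  ∏ l ∈ R, T.pathTr l

end TabSub

/-! ### Words in the free monoid `M_T` -/

/-- The transpose `uᵗ` of a word `u ∈ M_T` in the letters `1,…,s,1ᵗ,…,sᵗ`. -/
def wtp {s : ℕ} (w : List (Fin s × Bool)) : List (Fin s × Bool) :=
  (w.map fun p => (p.1, !p.2)).reverse

/-- Equality of words in `M_T` up to transposition (`=t`). -/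
def weqT {s : ℕ} (w w' : List (Fin s × Bool)) : Prop := w = w' ∨ w = wtp w'

/-- Equality of words in `M_T` up to cyclic permutation and transposition (`=ct`). -/
def weqCT {s : ℕ} (w w' : List (Fin s × Bool)) : Prop :=
  w.IsRotated w' ∨ w.IsRotated (wtp w')

/-- A word in a free monoid is primitive if it is not a power (with at least two
factors) of a word. -/
def PrimitiveWord {α : Type*} (w : List α) : Prop :=
  w ≠ [] ∧ ∀ (u : List α) (r : ℕ), 2 ≤ r → w ≠ (List.replicate r u).flatten

namespace TabSub

variable {A : Type} [CommRing A] {ι : Type} [Fintype ι] [DecidableEq ι] {n : ι → ℕ} {s : ℕ}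

/-! ### The tableau `T̃` -/

/-- The inclusion of the cells of the shape with the columns `q_1, q_2` deleted into the
cells of the original shape. -/
def embCell (q1 q2 : ι) (c : TabCell (fun i : {i : ι // i ≠ q1 ∧ i ≠ q2} => n i.1)) :
    TabCell n := ⟨c.1.1, c.2⟩

/-- The word in `M_T` corresponding to an arrow of `T̃` with tail cell `c'`: for an old
arrow (Case A) it is the single letter `φ(a)`; for an arrow coming from an open path
`l ∈ Ro` starting at `c'` (Case B) it is `φ(l)`. -/
noncomputable def tildeWord (T : TabSub A ι n s) (q1 q2 : ι)
    (Ro : Finset (List (TabCell n)))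
    (c' : TabCell (fun i : {i : ι // i ≠ q1 ∧ i ≠ q2} => n i.1)) : List (Fin s × Bool) :=
  if ((T.mate (embCell q1 q2 c')).1 ≠ q1 ∧ (T.mate (embCell q1 q2 c')).1 ≠ q2) then
    [T.letter (embCell q1 q2 c')]
  else
    T.word ((Ro.filter fun l => l.head? = some (embCell q1 q2 c')).toList.headI)

end TabSub

namespace TabSub

variable {A : Type} [CommRing A] {ι : Type} [Fintype ι] [DecidableEq ι] {n : ι → ℕ} {s : ℕ}

/-- `D` is (a tableau with substitution equal to) the tableau `T̃` associated with `T`,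
the columns `q_1, q_2`, and the set `Ro` of representatives of open paths.  Its arrows
are the arrows of `T` lying entirely outside the columns `q_1, q_2` (Case A, carrying
the same matrices), together with one arrow for each open path `l ∈ Ro`, going from the
tail of the first arrow of `l` to the head of its last arrow and carrying the matrix
`X_{φ(l)}` (Case B); two arrows of `D` carry the same label iff the corresponding words
in `M_T` coincide. -/
def IsTilde (T : TabSub A ι n s) (q1 q2 : ι) (Ro : Finset (List (TabCell n))) {t : ℕ}
    (D : TabSub A {i : ι // i ≠ q1 ∧ i ≠ q2} (fun i => n i.1) t) : Prop :=
  (∀ c' : TabCell (fun i : {i : ι // i ≠ q1 ∧ i ≠ q2} => n i.1),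
    ((T.mate (embCell q1 q2 c')).1 ≠ q1 ∧ (T.mate (embCell q1 q2 c')).1 ≠ q2) →
      D.isTail c' = T.isTail (embCell q1 q2 c') ∧
      embCell q1 q2 (D.mate c') = T.mate (embCell q1 q2 c') ∧
      ∀ i j, D.matOf c' i j = T.matOf (embCell q1 q2 c') i j) ∧
  (∀ l ∈ Ro, ∀ (h : l ≠ []) (h1 : (l.head h).1 ≠ q1 ∧ (l.head h).1 ≠ q2),
      D.isTail ⟨⟨(l.head h).1, h1⟩, (l.head h).2⟩ = true ∧
      embCell q1 q2 (D.mate ⟨⟨(l.head h).1, h1⟩, (l.head h).2⟩) = T.mate (l.getLast h) ∧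
      ∀ i j, D.matOf ⟨⟨(l.head h).1, h1⟩, (l.head h).2⟩ i j = T.pathMat l i j) ∧
  (∀ c' d', D.isTail c' = true → D.isTail d' = true →
      (D.lab c' = D.lab d' ↔ tildeWord T q1 q2 Ro c' = tildeWord T q1 q2 Ro d'))

end TabSub

/-! ### Quadruples and the sets `S_τ`, `S_{β,γ,b,c}` -/

/-- The data of a quadruple `(β,γ,b,c)` with `β ∈ ℕ^p`, `γ ∈ ℕ^q` and `b`, `c`
sequences of words in `M_T`. -/
structure QuadData (s : ℕ) where
  p : ℕ
  q : ℕ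
  β : Fin p → ℕ
  γ : Fin q → ℕ
  b : Fin p → List (Fin s × Bool)
  c : Fin q → List (Fin s × Bool)

namespace QuadData

variable {s : ℕ}

/-- `(β,γ,b,c)` is a `T`-quadruple: the `b_i`, `c_j` are primitive, the `b_i` are
pairwise different with respect to `=t` and the `c_j` pairwise different with respect
to `=ct`. -/
def IsQuad (Q : QuadData s) : Prop :=
  (∀ i, PrimitiveWord (Q.b i)) ∧ (∀ j, PrimitiveWord (Q.c j)) ∧
  (∀ i i', i ≠ i' → ¬ weqT (Q.b i) (Q.b i')) ∧
  (∀ j j', j ≠ j' → ¬ weqCT (Q.c j) (Q.c j'))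

/-- The multiset `{{b_1,…,b_1,…,b_p,…,b_p}}` with `b_i` of multiplicity `β_i`. -/
def mB (Q : QuadData s) : Multiset (List (Fin s × Bool)) :=
  ∑ i, Multiset.replicate (Q.β i) (Q.b i)

/-- The multiset `{{c_1,…,c_1,…,c_q,…,c_q}}` with `c_j` of multiplicity `γ_j`. -/
def mC (Q : QuadData s) : Multiset (List (Fin s × Bool)) :=
  ∑ j, Multiset.replicate (Q.γ j) (Q.c j)

/-- Equivalence of quadruples: the associated multisets agree up to `=t` (for `b`)
and up to `=ct` (for `c`). -/
def Equiv (Q Q' : QuadData s) : Prop :=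
  Multiset.Rel weqT Q.mB Q'.mB ∧ Multiset.Rel weqCT Q.mC Q'.mC

end QuadData

namespace TabSub

variable {A : Type} [CommRing A] {ι : Type} [Fintype ι] [DecidableEq ι] {n : ι → ℕ} {s : ℕ}

/-- The multiset `φ(T_o)` (or `φ(T_cl)`) of words in `M_T` of a set `R` of
representative paths. -/
def wordsOf (T : TabSub A ι n s) (R : Finset (List (TabCell n))) :
    Multiset (List (Fin s × Bool)) :=
  R.val.map T.word

/-- `ξ` witnesses the `T`-admissibility of the quadruple `Q`, with respect to the given
families `Ro ξ`, `Rcl ξ` of representatives of the open and closed paths of `T^ξ`: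
`φ(T^ξ_o) =t {{b_i with multiplicity β_i}}` and
`φ(T^ξ_cl) =ct {{c_j with multiplicity γ_j}}`. -/
def Witness (T : TabSub A ι n s) (q1 q2 : ι)
    (Ro Rcl : Finset (List (TabCell n))) (Q : QuadData s) : Prop :=
  Multiset.Rel weqT (T.wordsOf Ro) Q.mB ∧ Multiset.Rel weqCT (T.wordsOf Rcl) Q.mC

/-- The quadruple `Q` is `T`-admissible. -/
def Admissible (T : TabSub A ι n s) (q1 q2 : ι) (hn : n q1 = n q2)
    (Ro Rcl : Equiv.Perm (Fin (n q2)) → Finset (List (TabCell n)))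
    (Q : QuadData s) : Prop :=
  Q.IsQuad ∧ ∃ ξ : Equiv.Perm (Fin (n q2)), Witness (T.tw q2 ξ) q1 q2 (Ro ξ) (Rcl ξ) Q

/-- Membership `τ ∈ S_{β,γ,b,c}`: `φ(T^τ_o) =t {{b_i with multiplicity β_i}}` and
`φ(T^τ_cl) =ct {{c_1^{λ_{11}},…,c_1^{λ_{1l_1}},…,c_q^{λ_{q1}},…,c_q^{λ_{ql_q}}}}` for
some positive integers `λ_{ij}` with `λ_{i1}+⋯+λ_{il_i} = γ_i`. -/
def SQuadMem (T : TabSub A ι n s) (q1 q2 : ι)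
    (Ro Rcl : Equiv.Perm (Fin (n q2)) → Finset (List (TabCell n)))
    (Q : QuadData s) (τ : Equiv.Perm (Fin (n q2))) : Prop :=
  Multiset.Rel weqT ((T.tw q2 τ).wordsOf (Ro τ)) Q.mB ∧
  ∃ L : Fin Q.q → Multiset ℕ,
    (∀ j, (∀ x ∈ L j, 0 < x) ∧ (L j).sum = Q.γ j) ∧
    Multiset.Rel weqCT ((T.tw q2 τ).wordsOf (Rcl τ))
      (∑ j, (L j).map fun lam => (List.replicate lam (Q.c j)).flatten)

/-- The set `S_τ` of permutations `π` with `φ(T^π_o) =t φ(T^τ_o)` and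
`φ(T^π_cl) =ct φ(T^τ_cl)`. -/
def SPerm (T : TabSub A ι n s) (q1 q2 : ι)
    (Ro Rcl : Equiv.Perm (Fin (n q2)) → Finset (List (TabCell n)))
    (τ : Equiv.Perm (Fin (n q2))) : Set (Equiv.Perm (Fin (n q2))) :=
  {π | Multiset.Rel weqT ((T.tw q2 π).wordsOf (Ro π)) ((T.tw q2 τ).wordsOf (Ro τ)) ∧
       Multiset.Rel weqCT ((T.tw q2 π).wordsOf (Rcl π)) ((T.tw q2 τ).wordsOf (Rcl τ))}

/-! ### Auxiliary constructions for Lemmas about `T^π` -/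

/-- The word of arrows of `T` underlying a word of arrows of `T^τ`. -/
def underlying (T : TabSub A ι n s) (q2 : ι) (τ : Equiv.Perm (Fin (n q2)))
    (l : List (TabCell n)) : List (TabCell n) :=
  l.map (colPerm n q2 τ).symm

/-- The cell number of a cell lying in column `q_1` or `q_2`, as an element of
`Fin (n q2)` (using `n q1 = n q2`). -/
def toQ2 {q1 q2 : ι} (hn : n q1 = n q2) (c : TabCell n) (h : c.1 = q1 ∨ c.1 = q2) :
    Fin (n q2) :=
  if h2 : c.1 = q2 then Fin.cast (congrArg n h2) c.2
  else Fin.cast ((congrArg n (h.resolve_right h2)).trans hn) c.2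

/-- The substitution `a → b, b → a` on oriented arrows (hence also `aᵗ → bᵗ, bᵗ → aᵗ`). -/
def swapSub (T : TabSub A ι n s) (a b : TabCell n) (c : TabCell n) : TabCell n :=
  if c = a then b else if c = b then a
  else if c = T.mate a then T.mate b else if c = T.mate b then T.mate a else c

end TabSub

namespace TabSub

variable {A : Type} [CommRing A] {ι : Type} [Fintype ι] [DecidableEq ι] {n : ι → ℕ} {s : ℕ}

theorem colPerm_same (q : ι) (τ : Equiv.Perm (Fin (n q))) (x : Fin (n q)) :
    colPerm n q τ ⟨q, x⟩ = ⟨q, τ x⟩ := by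
  simp [colPerm, Equiv.sigmaCongrRight, Equiv.permCongr_apply]

theorem colPerm_ne (q : ι) (τ : Equiv.Perm (Fin (n q))) (c : TabCell n) (h : c.1 ≠ q) :
    colPerm n q τ c = c := by
  obtain ⟨i, x⟩ := c
  simp only at h
  simp [colPerm, Equiv.sigmaCongrRight, h]

theorem colPerm_mul (q : ι) (σ τ : Equiv.Perm (Fin (n q))) :
    colPerm n q (σ * τ) = (colPerm n q τ).trans (colPerm n q σ) := by
  ext1 c
  by_cases h : c.1 = q
  · obtain ⟨i, x⟩ := c
    simp only at h
    subst h
    simp [colPerm_same]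
  · simp [colPerm_ne _ _ _ h]

theorem permTab_congr (T : TabSub A ι n s) (ρ ρ' : Equiv.Perm (TabCell n))
    (h : ∀ c, (ρ c).1 = c.1) (h' : ∀ c, (ρ' c).1 = c.1) (e : ρ = ρ') :
    T.permTab ρ h = T.permTab ρ' h' := by
  subst e; rfl

theorem tw_mul (T : TabSub A ι n s) (q : ι) (σ τ : Equiv.Perm (Fin (n q))) :
    T.tw q (σ * τ) = (T.tw q τ).tw q σ := by
  have : (T.tw q τ).tw q σ = T.permTab ((colPerm n q τ).trans (colPerm n q σ))
    (fun _ => rfl) := rfl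
  rw [this]
  exact permTab_congr _ _ _ _ _ (colPerm_mul q σ τ)

theorem matOf_mate (T : TabSub A ι n s) (c : TabCell n) (i j : ℕ) :
    T.matOf (T.mate c) i j = T.matOf c j i := by
  unfold matOf
  rw [T.lab_mate, T.isTail_mate]
  cases T.isTail c <;> simp

theorem tp_tp (T : TabSub A ι n s) (l : List (TabCell n)) : T.tp (T.tp l) = l := by
  simp [tp, Function.comp_def, T.mate_invol]

theorem le_dimBound (i : ι) : n i ≤ dimBound n := by
  unfold dimBound
  exact Finset.single_le_sum (f := n) (fun _ _ => Nat.zero_le _) (Finset.mem_univ i)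

/-- finite matrix version -/
def fm (B : ℕ) (f : ℕ → ℕ → A) : Matrix (Fin B) (Fin B) A := Matrix.of fun i j => f i j

theorem fm_matListProd (B : ℕ) (fs : List (ℕ → ℕ → A)) :
    fm B (matListProd B fs) = (fs.map (fm B)).prod := by
  induction fs with
  | nil =>
    ext i j
    simp [fm, matListProd, Matrix.one_apply, Fin.ext_iff]
  | cons f fs ih =>
    rw [List.map_cons, List.prod_cons, ← ih]
    ext i j
    simp [fm, matListProd, Matrix.mul_apply, Finset.sum_range]

theorem fm_tp (T : TabSub A ι n s) (l : List (TabCell n)) :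
    fm (dimBound n) (T.pathMat (T.tp l)) = (fm (dimBound n) (T.pathMat l)).transpose := by
  unfold pathMat
  rw [fm_matListProd, fm_matListProd, Matrix.transpose_list_prod]
  congr 1
  simp only [tp, List.map_reverse, List.map_map]
  congr 1
  apply List.map_congr_left
  intro c _
  ext i j
  simp [fm, matOf_mate]

theorem pathMat_tp (T : TabSub A ι n s) (l : List (TabCell n)) (i j : ℕ)
    (hi : i < dimBound n) (hj : j < dimBound n) :
    T.pathMat (T.tp l) i j = T.pathMat l j i :=
  congrFun (congrFun (fm_tp T l) ⟨i, hi⟩) ⟨j, hj⟩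

theorem pathTr_eq (T : TabSub A ι n s) (l : List (TabCell n)) :
    T.pathTr l = (fm (dimBound n) (T.pathMat l)).trace := by
  simp [pathTr, Matrix.trace, fm, Finset.sum_range]

theorem pathTr_tp (T : TabSub A ι n s) (l : List (TabCell n)) :
    T.pathTr (T.tp l) = T.pathTr l := by
  rw [pathTr_eq, pathTr_eq, fm_tp, Matrix.trace_transpose]

theorem pathTr_rot (T : TabSub A ι n s) {l l' : List (TabCell n)} (h : l.IsRotated l') :
    T.pathTr l = T.pathTr l' := by
  obtain ⟨k, hk, rfl⟩ := List.isRotated_iff_mod.1 h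
  rw [List.rotate_eq_drop_append_take hk]
  conv_lhs => rw [← List.take_append_drop k l]
  rw [pathTr_eq, pathTr_eq]
  unfold pathMat
  rw [fm_matListProd, fm_matListProd, List.map_append, List.map_append, List.map_append,
    List.map_append, List.prod_append, List.prod_append, Matrix.trace_mul_comm]

theorem pathTr_eqCT (T : TabSub A ι n s) {l l' : List (TabCell n)} (h : T.eqCT l l') :
    T.pathTr l = T.pathTr l' := by
  rcases h with h | h
  · exact pathTr_rot T h
  · rw [pathTr_rot T h, pathTr_tp]

theorem rot_tp (T : TabSub A ι n s) {l l' : List (TabCell n)} (h : l.IsRotated l') :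
    (T.tp l).IsRotated (T.tp l') := by
  unfold tp
  exact (h.map _).reverse

theorem eqCT_symm (T : TabSub A ι n s) {l l' : List (TabCell n)} (h : T.eqCT l l') :
    T.eqCT l' l := by
  rcases h with h | h
  · exact Or.inl h.symm
  · right
    have := rot_tp T h
    rw [tp_tp] at this
    exact this.symm

theorem eqCT_trans (T : TabSub A ι n s) {l l' l'' : List (TabCell n)} (h : T.eqCT l l')
    (h' : T.eqCT l' l'') : T.eqCT l l'' := by
  rcases h with h | h <;> rcases h' with h' | h'
  · exact Or.inl (h.trans h')
  · exact Or.inr (h.trans h')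
  · exact Or.inr (h.trans (rot_tp T h'))
  · left
    have := h.trans (rot_tp T h')
    rwa [tp_tp] at this

theorem trClosed_reps (T : TabSub A ι n s) (q1 q2 : ι) (R R' : Finset (List (TabCell n)))
    (h : T.ClosedReps q1 q2 R) (h' : T.ClosedReps q1 q2 R') :
    T.trClosed R = T.trClosed R' := by
  have key : ∀ l ∈ R, ∃ l', l' ∈ R' ∧ T.eqCT l l' := fun l hl => (h'.2 l (h.1 l hl)).exists
  choose! F hF using key
  unfold trClosed
  refine Finset.prod_bij (fun l _ => F l) (fun l hl => (hF l hl).1) ?_ ?_ ?_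
  · intro l1 h1 l2 h2 e
    have e1 := (hF l1 h1).2
    have e2 := (hF l2 h2).2
    replace e : F l1 = F l2 := e
    rw [← e] at e2
    exact (h.2 l1 (h.1 l1 h1)).unique ⟨h1, Or.inl (List.IsRotated.refl _)⟩
      ⟨h2, eqCT_trans T e1 (eqCT_symm T e2)⟩
  · intro l' hl'
    obtain ⟨l, hl, e⟩ := (h.2 l' (h'.1 l' hl')).exists
    refine ⟨l, hl, ?_⟩
    exact (h'.2 l (h.1 l hl)).unique (hF l hl) ⟨hl', eqCT_symm T e⟩
  · intro l hl
    exact pathTr_eqCT T (hF l hl).2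

/-- An isomorphism of tableaux compatible with the path structure. -/
structure Iso (q1 q2 : ι) (T1 T2 : TabSub A ι n s) (ψ : Equiv.Perm (TabCell n)) : Prop where
  col : ∀ c, (ψ c).1 = c.1
  mate : ∀ c, T2.mate (ψ c) = ψ (T1.mate c)
  mat : ∀ c, T2.matOf (ψ c) = T1.matOf c
  num : ∀ c d, (c.1 = q1 ∨ c.1 = q2) → (d.1 = q1 ∨ d.1 = q2) →
    (((ψ c).2 : ℕ) = ((ψ d).2 : ℕ) ↔ (c.2 : ℕ) = (d.2 : ℕ))

namespace Iso

variable {q1 q2 : ι} {T1 T2 : TabSub A ι n s} {ψ : Equiv.Perm (TabCell n)}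

theorem symm (h : Iso q1 q2 T1 T2 ψ) : Iso q1 q2 T2 T1 ψ.symm where
  col c := by simpa using (h.col (ψ.symm c)).symm
  mate c := by
    apply ψ.injective
    rw [← h.mate]; simp
  mat c := by
    rw [← h.mat]; simp
  num c d hc hd := by
    have e1 := h.col (ψ.symm c)
    have e2 := h.col (ψ.symm d)
    rw [Equiv.apply_symm_apply] at e1 e2
    have := h.num (ψ.symm c) (ψ.symm d) (by rwa [← e1]) (by rwa [← e2])
    have e3 : ψ (ψ.symm c) = c := by simp
    have e4 : ψ (ψ.symm d) = d := by simp
    rw [e3, e4] at this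
    exact this.symm

theorem succ_iff (h : Iso q1 q2 T1 T2 ψ) (c d : TabCell n) :
    T2.Succ q1 q2 (ψ c) (ψ d) ↔ T1.Succ q1 q2 c d := by
  unfold Succ
  rw [h.mate]
  have e1 := h.col (T1.mate c)
  have e2 := h.col d
  constructor
  · rintro ⟨h1, h2, h3, h4⟩
    replace h1 := e1 ▸ h1
    replace h2 := e2 ▸ h2
    exact ⟨h1, h2, fun e => h3 (by rw [e1, e2, e]), (h.num _ _ h1 h2).1 h4⟩
  · rintro ⟨h1, h2, h3, h4⟩
    exact ⟨e1.symm ▸ h1, e2.symm ▸ h2, fun e => h3 (by rw [← e1, ← e2, e]),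
      (h.num _ _ h1 h2).2 h4⟩

theorem isPath (h : Iso q1 q2 T1 T2 ψ) {l : List (TabCell n)} (hl : T1.IsPath q1 q2 l) :
    T2.IsPath q1 q2 (l.map ψ) := by
  obtain ⟨h1, h2, h3⟩ := hl
  refine ⟨by simpa using h1, ?_, h3.map ψ.injective⟩
  show List.IsChain _ _
  rw [List.isChain_map]
  exact List.IsChain.imp (fun a b hab => (h.succ_iff a b).2 hab) h2

theorem isOpen (h : Iso q1 q2 T1 T2 ψ) {l : List (TabCell n)} (hl : T1.IsOpenPath q1 q2 l) :
    T2.IsOpenPath q1 q2 (l.map ψ) := by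
  obtain ⟨h1, h2, h3⟩ := hl
  refine ⟨h.isPath h1, by simpa using h2, fun h0 => ?_⟩
  have := h3 h1.1
  rw [List.head_map, List.getLast_map, h.mate, h.col, h.col]
  exact this

theorem isClosed (h : Iso q1 q2 T1 T2 ψ) {l : List (TabCell n)}
    (hl : T1.IsClosedPath q1 q2 l) : T2.IsClosedPath q1 q2 (l.map ψ) := by
  obtain ⟨h1, h3⟩ := hl
  refine ⟨h.isPath h1, fun h0 => ?_⟩
  have := h3 h1.1
  rw [List.head_map, List.getLast_map, h.succ_iff]
  exact this

theorem pathMat_map (h : Iso q1 q2 T1 T2 ψ) (l : List (TabCell n)) :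
    T2.pathMat (l.map ψ) = T1.pathMat l := by
  unfold pathMat
  rw [List.map_map]
  congr 1
  exact List.map_congr_left fun c _ => h.mat c

theorem tp_map (h : Iso q1 q2 T1 T2 ψ) (l : List (TabCell n)) :
    T2.tp (l.map ψ) = (T1.tp l).map ψ := by
  simp [tp, h.mate, Function.comp_def]

theorem eqCT_map (h : Iso q1 q2 T1 T2 ψ) {l l' : List (TabCell n)} (e : T1.eqCT l l') :
    T2.eqCT (l.map ψ) (l'.map ψ) := by
  rcases e with e | e
  · exact Or.inl (e.map _)
  · right
    rw [h.tp_map]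
    exact e.map _

theorem trClosed (h : Iso q1 q2 T1 T2 ψ) (R1 R2 : Finset (List (TabCell n)))
    (h1 : T1.ClosedReps q1 q2 R1) (h2 : T2.ClosedReps q1 q2 R2) :
    T2.trClosed R2 = T1.trClosed R1 := by
  have inj : Function.Injective (List.map ψ) := List.map_injective_iff.2 ψ.injective
  have back : ∀ l : List (TabCell n), (l.map ψ.symm).map ψ = l := by intro l; simp
  have forth : ∀ l : List (TabCell n), (l.map ψ).map ψ.symm = l := by intro l; simp
  have : T2.ClosedReps q1 q2 (R1.map ⟨List.map ψ, inj⟩) := by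
    refine ⟨?_, ?_⟩
    · intro l hl
      obtain ⟨l0, hl0, rfl⟩ := Finset.mem_map.1 hl
      exact h.isClosed (h1.1 _ hl0)
    · intro l hl
      obtain ⟨l', ⟨hl', e⟩, u⟩ := h1.2 _ (h.symm.isClosed hl)
      refine ⟨l'.map ψ, ⟨Finset.mem_map.2 ⟨l', hl', rfl⟩, ?_⟩, ?_⟩
      · have := h.eqCT_map e
        rwa [back] at this
      · rintro l'' ⟨hl'', e''⟩
        obtain ⟨l0, hl0, rfl⟩ := Finset.mem_map.1 hl''
        have := h.symm.eqCT_map e''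
        have e3 := u l0 ⟨hl0, by simpa [forth] using this⟩
        rw [e3]; rfl
  rw [trClosed_reps T2 q1 q2 _ _ h2 this]
  unfold TabSub.trClosed
  rw [Finset.prod_map]
  refine Finset.prod_congr rfl fun l _ => ?_
  simp [pathTr, h.pathMat_map]

end Iso

theorem exists_open (T : TabSub A ι n s) {q1 q2 : ι} (hq : q1 ≠ q2) (hn : n q1 = n q2)
    (c : TabCell n) (hc : c.1 ≠ q1 ∧ c.1 ≠ q2)
    (hm : (T.mate c).1 = q1 ∨ (T.mate c).1 = q2) :
    ∃ l, T.IsOpenPath q1 q2 l ∧ ∃ h : l ≠ [], l.head h = c := by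
  let P : ℕ → Prop := fun k => ∃ l : List (TabCell n), T.IsPath q1 q2 l ∧
    (∃ h : l ≠ [], l.head h = c) ∧ l.length = k
  have hP1 : P 1 := ⟨[c], ⟨by simp, List.isChain_singleton c, by simp⟩, ⟨by simp, rfl⟩, rfl⟩
  have hbd : ∀ k, P k → k ≤ Fintype.card (TabCell n) := by
    rintro k ⟨l, hl, -, rfl⟩
    exact hl.2.2.length_le_card
  obtain ⟨l, hl, ⟨h0, hh⟩, hlen⟩ := Nat.findGreatest_spec (P := P) (hbd 1 hP1) hP1
  have hmax : ∀ k, P k → k ≤ l.length := by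
    intro k hk
    rw [hlen]
    exact Nat.le_findGreatest (hbd k hk) hk
  have hout : (T.mate (l.getLast h0)).1 ≠ q1 ∧ (T.mate (l.getLast h0)).1 ≠ q2 := by
    by_contra hcon
    have hin : (T.mate (l.getLast h0)).1 = q1 ∨ (T.mate (l.getLast h0)).1 = q2 := by
      by_contra h; push Not at h; exact hcon h
    have hd : ∃ d, T.Succ q1 q2 (l.getLast h0) d := by
      rcases hin with hin | hin
      · refine ⟨⟨q2, Fin.cast ((congrArg n hin).trans hn) (T.mate (l.getLast h0)).2⟩,
          Or.inl hin, Or.inr rfl, ?_, rfl⟩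
        intro e; exact hq (hin.symm.trans e)
      · refine ⟨⟨q1, Fin.cast ((congrArg n hin).trans hn.symm) (T.mate (l.getLast h0)).2⟩,
          Or.inr hin, Or.inl rfl, ?_, rfl⟩
        intro e; exact hq (hin.symm.trans e).symm
    obtain ⟨d, hd⟩ := hd
    by_cases hdl : d ∈ l
    · obtain ⟨k, hk, hkd⟩ := List.getElem_of_mem hdl
      rcases k with _ | k
      · rw [← List.head_eq_getElem h0, hh] at hkd
        subst hkd
        rcases hd.2.1 with h | h
        · exact hc.1 h
        · exact hc.2 h
      · have hs : T.Succ q1 q2 l[k] l[k+1] := (List.isChain_iff_getElem.1 hl.2.1) k hk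
        rw [hkd] at hs
        have heq : T.mate l[k] = T.mate (l.getLast h0) := by
          obtain ⟨s1, s2, s3, s4⟩ := hs
          obtain ⟨t1, t2, t3, t4⟩ := hd
          have hcol : (T.mate l[k]).1 = (T.mate (l.getLast h0)).1 := by
            grind
          refine Sigma.ext hcol ?_
          refine (Fin.heq_ext_iff (congrArg n hcol)).2 ?_
          rw [s4, t4]
        have heq2 := T.mate.injective heq
        rw [List.getLast_eq_getElem] at heq2
        have := (hl.2.2.getElem_inj_iff).1 heq2
        omega
    · have : P (l.length + 1) := by
        refine ⟨l ++ [d], ⟨by simp, ?_, ?_⟩, ⟨by simp, ?_⟩, by simp⟩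
        · show List.IsChain _ _
          rw [List.isChain_append]
          refine ⟨hl.2.1, by simp, ?_⟩
          intro x hx y hy
          rw [List.getLast?_eq_getLast_of_ne_nil h0] at hx
          simp at hx hy
          subst hx; subst hy; exact hd
        · rw [List.nodup_append]
          refine ⟨hl.2.2, by simp, ?_⟩
          intro x hx y hy e
          simp at hy
          subst hy; subst e; exact hdl hx
        · rw [List.head_append_of_ne_nil h0]; exact hh
      have := hmax _ this
      omega
  refine ⟨l, ⟨hl, ?_, fun _ => ⟨by rw [hh]; exact hc, hout⟩⟩, h0, hh⟩
  by_contra hlt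
  match l, h0, hlt with
  | [x], h0, _ =>
    simp at hh hout
    subst hh
    rcases hm with h | h
    · exact hout.1 h
    · exact hout.2 h
  | x :: y :: l, _, hlt => simp at hlt

theorem embCell_inj (q1 q2 : ι) : Function.Injective (embCell (n := n) q1 q2) := by
  rintro ⟨⟨i, hi⟩, x⟩ ⟨⟨j, hj⟩, y⟩ h
  simp only [embCell, Sigma.mk.injEq] at h
  obtain ⟨rfl, h⟩ := h
  cases h; rfl

theorem tilde_char (T : TabSub A ι n s) {q1 q2 : ι} (Ro : Finset (List (TabCell n)))
    (hRo : T.OpenReps q1 q2 Ro) {t : ℕ}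
    (D : TabSub A {i : ι // i ≠ q1 ∧ i ≠ q2} (fun i => n i.1) t)
    (hD : T.IsTilde q1 q2 Ro D) (l : List (TabCell n)) (hl : T.IsOpenPath q1 q2 l)
    (h0 : l ≠ []) (c' : TabCell (fun i : {i : ι // i ≠ q1 ∧ i ≠ q2} => n i.1))
    (hc : l.head h0 = embCell q1 q2 c') :
    embCell q1 q2 (D.mate c') = T.mate (l.getLast h0) ∧
    ∀ i j, i < dimBound n → j < dimBound n → D.matOf c' i j = T.pathMat l i j := by
  obtain ⟨l', hl', e⟩ := (hRo.2 l hl).exists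
  have ho := hRo.1 l' hl'
  have h0' := ho.1.1
  have h3 := (ho.2.2 h0').1
  have key := hD.2.1 l' hl' h0' h3
  set d : TabCell (fun i : {i : ι // i ≠ q1 ∧ i ≠ q2} => n i.1) :=
    ⟨⟨(l'.head h0').1, h3⟩, (l'.head h0').2⟩ with hd
  have hde : embCell q1 q2 d = l'.head h0' := rfl
  obtain ⟨k1, k2, k3⟩ := key
  rcases e with e | e
  · subst e
    have : d = c' := embCell_inj q1 q2 (hde.trans hc)
    rw [← this]
    exact ⟨k2, fun i j _ _ => k3 i j⟩
  · have hlast : T.mate (l.getLast h0) = l'.head h0' := by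
      subst e
      simp [tp, T.mate_invol]
    have hhead : l.head h0 = T.mate (l'.getLast h0') := by
      subst e
      simp [tp]
    have hdm : D.mate d = c' := by
      apply embCell_inj q1 q2
      rw [k2, ← hc, hhead]
    have hcm : D.mate c' = d := by rw [← hdm, D.mate_invol]
    refine ⟨by rw [hcm, hlast, hde], ?_⟩
    intro i j hi hj
    rw [← hdm, matOf_mate, k3, e, pathMat_tp _ _ _ _ hi hj]

theorem prod_transversal {α : Type} [Fintype α] (μ : Equiv.Perm α) (hμ : ∀ c, μ (μ c) = c)
    (f : α → A) (hf : ∀ c, f (μ c) = f c) (S S' : Finset α)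
    (hS : ∀ c, μ c ∈ S ↔ c ∉ S) (hS' : ∀ c, μ c ∈ S' ↔ c ∉ S') :
    ∏ c ∈ S, f c = ∏ c ∈ S', f c := by
  refine Finset.prod_bij' (fun c _ => if c ∈ S' then c else μ c)
    (fun c _ => if c ∈ S then c else μ c) ?_ ?_ ?_ ?_ ?_
  · intro c hc; split_ifs with h
    · exact h
    · exact (hS' c).2 h
  · intro c hc; split_ifs with h
    · exact h
    · exact (hS c).2 h
  · intro c hc
    by_cases h : c ∈ S'
    · simp [h, hc]
    · have : μ c ∉ S := fun h' => (hS c).1 h' hc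
      simp [h, this, hμ]
  · intro c hc
    by_cases h : c ∈ S
    · simp [h, hc]
    · have : μ c ∉ S' := fun h' => (hS' c).1 h' hc
      simp [h, this, hμ]
  · intro c hc; split_ifs with h
    · rfl
    · rw [hf]

/-- symmetric weight -/
def wt (D : TabSub A ι n s) (π : ∀ i : ι, Equiv.Perm (Fin (n i))) (c : TabCell n) : A :=
  D.matOf c (π c.1 c.2 : Fin (n c.1)).1
    ((π (D.mate c).1 (D.mate c).2 : Fin (n (D.mate c).1)).1)

theorem wt_mate (D : TabSub A ι n s) (π : ∀ i : ι, Equiv.Perm (Fin (n i))) (c : TabCell n) :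
    D.wt π (D.mate c) = D.wt π c := by
  unfold wt
  rw [matOf_mate, D.mate_invol]

theorem bpf0_wt (D : TabSub A ι n s) :
    D.bpf0 = ∑ π : ∀ i : ι, Equiv.Perm (Fin (n i)), sgnT π • ∏ c ∈ D.tails, D.wt π c := by
  unfold bpf0
  refine Finset.sum_congr rfl fun π _ => ?_
  congr 1
  refine Finset.prod_congr rfl fun c hc => ?_
  have : D.isTail c = true := by simpa [tails] using hc
  simp [wt, entry, matOf, this]

theorem bpf0_neg {t1 t2 : ℕ} (D1 : TabSub A ι n t1) (D2 : TabSub A ι n t2) (q : ι)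
    (x y : Fin (n q)) (hxy : x ≠ y)
    (hmate : ∀ c, D2.mate (colPerm n q (Equiv.swap x y) c) =
      colPerm n q (Equiv.swap x y) (D1.mate c))
    (hmat : ∀ c, ∀ i j, i < n c.1 → j < n (D1.mate c).1 →
      D2.matOf (colPerm n q (Equiv.swap x y) c) i j = D1.matOf c i j) :
    D2.bpf0 = - D1.bpf0 := by
  rw [bpf0_wt, bpf0_wt, ← Finset.sum_neg_distrib]
  set θ := colPerm n q (Equiv.swap x y) with hθ
  let δ : ∀ i : ι, Equiv.Perm (Fin (n i)) := Pi.mulSingle q (Equiv.swap x y)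
  have hcol : ∀ (π : ∀ i : ι, Equiv.Perm (Fin (n i))) (c : TabCell n),
      ((π (θ c).1 (θ c).2 : Fin (n (θ c).1)) : ℕ) = (((π * δ) c.1 c.2 : Fin (n c.1)) : ℕ) := by
    intro π c
    by_cases h : c.1 = q
    · obtain ⟨i, z⟩ := c
      simp only at h
      subst h
      rw [hθ, colPerm_same]
      simp [δ]
    · rw [hθ, colPerm_ne _ _ _ h]
      simp [δ, Pi.mulSingle_eq_of_ne h]
  refine Fintype.sum_equiv (Equiv.mulRight δ) _ _ fun π => ?_
  have hs : sgnT (π * δ) = - sgnT π := by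
    have hδ : ∏ i, ((Equiv.Perm.sign (δ i) : ℤˣ) : ℤ) = -1 := by
      rw [Finset.prod_eq_single q]
      · simp [δ, Equiv.Perm.sign_swap hxy]
      · intro i _ hi
        simp [δ, Pi.mulSingle_eq_of_ne hi]
      · simp
    unfold sgnT
    simp only [Pi.mul_apply, Equiv.Perm.sign_mul, Units.val_mul, Finset.prod_mul_distrib]
    rw [hδ]; ring
  simp only [Equiv.coe_mulRight]
  rw [hs, neg_smul, neg_neg]
  congr 1
  have hw : ∀ c, D2.wt π (θ c) = D1.wt (π * δ) c := by
    intro c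
    unfold wt
    rw [hmate, hcol, hcol]
    exact hmat _ _ _ (Fin.is_lt _) (Fin.is_lt _)
  have e1 : ∏ c ∈ D2.tails, D2.wt π c =
      ∏ c ∈ D2.tails.map θ.symm.toEmbedding, D1.wt (π * δ) c := by
    rw [Finset.prod_map]
    refine Finset.prod_congr rfl fun c _ => ?_
    rw [← hw]; simp
  rw [e1]
  refine prod_transversal D1.mate D1.mate_invol _ (wt_mate D1 _) _ _ ?_ ?_
  · intro c
    have : ∀ c, c ∈ D2.tails.map θ.symm.toEmbedding ↔ D2.isTail (θ c) = true := by
      intro c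
      simp [tails, Finset.mem_map_equiv]
    rw [this, this, ← hmate, D2.isTail_mate]
    simp
  · intro c
    simp [tails, D1.isTail_mate]

end TabSub

namespace TabSub

variable {A : Type} [CommRing A] {ι : Type} [Fintype ι] [DecidableEq ι] {n : ι → ℕ} {s : ℕ}

theorem swap_cell (i : ι) (x y : Fin (n i)) :
    Equiv.swap (⟨i, x⟩ : TabCell n) ⟨i, y⟩ = colPerm n i (Equiv.swap x y) := by
  ext1 c
  by_cases h : c.1 = i
  · obtain ⟨j, z⟩ := c
    simp only at h
    subst h
    rw [colPerm_same]
    simp only [Equiv.swap_apply_def]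
    split_ifs <;> simp_all
  · rw [colPerm_ne _ _ _ h, Equiv.swap_apply_of_ne_of_ne]
    · rintro rfl; exact h rfl
    · rintro rfl; exact h rfl

/-- The automorphism of `T` exchanging the arrows `a` and `b`. -/
noncomputable def chi (T : TabSub A ι n s) (a b : TabCell n) : Equiv.Perm (TabCell n) :=
  Equiv.swap a b * Equiv.swap (T.mate a) (T.mate b)

theorem chi_props (T : TabSub A ι n s) (a b : TabCell n) (hab : a ≠ b)
    (hφ : T.letter a = T.letter b) (c : TabCell n) :
    T.mate (T.chi a b c) = T.chi a b (T.mate c) ∧ T.lab (T.chi a b c) = T.lab c ∧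
      T.isTail (T.chi a b c) = T.isTail c := by
  have hl : T.lab a = T.lab b := congrArg Prod.fst hφ
  have ht : T.isTail a = T.isTail b := by
    have := congrArg Prod.snd hφ
    simpa [letter] using this
  have h1 : T.mate a ≠ T.mate b := fun h => hab (T.mate.injective h)
  have h2 : T.mate a ≠ b := fun h => by
    have := T.isTail_mate a
    rw [h, ht] at this
    simp at this
  have h3 : T.mate b ≠ a := fun h => by
    have := T.isTail_mate b
    rw [h, ht] at this
    simp at this
  have h4 := T.mate_ne a
  have h5 := T.mate_ne b
  have ma := T.mate_invol a
  have mb := T.mate_invol b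
  have la := T.lab_mate a
  have lb := T.lab_mate b
  have ta := T.isTail_mate a
  have tb := T.isTail_mate b
  have va : T.chi a b a = b := by
    simp [chi, Equiv.swap_apply_of_ne_of_ne h4.symm h3.symm]
  have vb : T.chi a b b = a := by
    simp [chi, Equiv.swap_apply_of_ne_of_ne h2.symm h5.symm]
  have vma : T.chi a b (T.mate a) = T.mate b := by
    simp [chi, Equiv.swap_apply_of_ne_of_ne h3 h5]
  have vmb : T.chi a b (T.mate b) = T.mate a := by
    simp [chi, Equiv.swap_apply_of_ne_of_ne h4 h2]
  have vo : ∀ d, d ≠ a → d ≠ b → d ≠ T.mate a → d ≠ T.mate b → T.chi a b d = d := by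
    intro d d1 d2 d3 d4
    simp [chi, Equiv.swap_apply_of_ne_of_ne d3 d4, Equiv.swap_apply_of_ne_of_ne d1 d2]
  by_cases c1 : c = a
  · subst c1; rw [va, vma]; exact ⟨rfl, hl.symm, ht.symm⟩
  by_cases c2 : c = b
  · subst c2; rw [vb, vmb]; exact ⟨rfl, hl, ht⟩
  by_cases c3 : c = T.mate a
  · subst c3; rw [vma, ma, mb, va, la, lb, ta, tb, hl, ht]; exact ⟨rfl, rfl, rfl⟩
  by_cases c4 : c = T.mate b
  · subst c4; rw [vmb, ma, mb, vb, la, lb, ta, tb, hl, ht]; exact ⟨rfl, rfl, rfl⟩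
  rw [vo c c1 c2 c3 c4, vo (T.mate c)]
  · exact ⟨rfl, rfl, rfl⟩
  · rintro h; exact c3 (by rw [← h, T.mate_invol])
  · rintro h; exact c4 (by rw [← h, T.mate_invol])
  · intro h; exact c1 (T.mate.injective h)
  · intro h; exact c2 (T.mate.injective h)

theorem tw_iso_aux (T : TabSub A ι n s) {q1 q2 : ι} (hq : q1 ≠ q2) (hn : n q1 = n q2)
    (a b : TabCell n) (hab : a ≠ b) (hφ : T.letter a = T.letter b) (htail : a.1 = b.1)
    (htailq : a.1 ≠ q1 ∧ a.1 ≠ q2) (ma mb : TabCell n) (hma : T.mate a = ma)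
    (hmb : T.mate b = mb) (hhead : ma.1 = mb.1) (ha : ma.1 = q1 ∨ ma.1 = q2)
    (hb : mb.1 = q1 ∨ mb.1 = q2) :
    ∃ ψ, Iso q1 q2 T (T.tw q2 (Equiv.swap (toQ2 hn ma ha) (toQ2 hn mb hb))) ψ ∧
      (∀ c, c.1 ≠ q1 → c.1 ≠ q2 → ψ c = Equiv.swap a b c) ∧
      toQ2 hn ma ha ≠ toQ2 hn mb hb := by
  have hmab : ma ≠ mb := by
    rw [← hma, ← hmb]; exact fun h => hab (T.mate.injective h)
  set sw := Equiv.swap (toQ2 hn ma ha) (toQ2 hn mb hb) with hsw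
  have hchi : T.chi a b = Equiv.swap a b * Equiv.swap ma mb := by
    unfold chi; rw [hma, hmb]
  obtain ⟨i0, x⟩ := a
  obtain ⟨i0', y⟩ := b
  simp only at htail htailq
  subst htail
  obtain ⟨h, p⟩ := ma
  obtain ⟨h', p'⟩ := mb
  simp only at hhead
  subst hhead
  rw [swap_cell, swap_cell] at hchi
  have hpp : p ≠ p' := fun e => hmab (by rw [e])
  have hcolchi : ∀ c, (T.chi ⟨i0, x⟩ ⟨i0, y⟩ c).1 = c.1 := by
    intro c; rw [hchi]; rfl
  -- action of chi on the distinguished columns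
  have chi_in : ∀ c : TabCell n, (c.1 = q1 ∨ c.1 = q2) →
      T.chi ⟨i0, x⟩ ⟨i0, y⟩ c = colPerm n h (Equiv.swap p p') c := by
    intro c hc
    rw [hchi, Equiv.Perm.mul_apply, colPerm_ne]
    intro e
    have e' : c.1 = i0 := e
    rw [e'] at hc
    exact hc.elim htailq.1 htailq.2
  refine ⟨(T.chi ⟨i0, x⟩ ⟨i0, y⟩).trans (colPerm n q2 sw), ⟨?_, ?_, ?_, ?_⟩, ?_, ?_⟩
  · intro c; exact hcolchi c
  · intro c
    simp [tw, permTab, (chi_props T _ _ hab hφ c).1]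
  · intro c
    have h2 := (chi_props T _ _ hab hφ c).2.1
    have h3 := (chi_props T _ _ hab hφ c).2.2
    have : (T.tw q2 sw).matOf (colPerm n q2 sw (T.chi ⟨i0, x⟩ ⟨i0, y⟩ c)) =
        T.matOf (T.chi ⟨i0, x⟩ ⟨i0, y⟩ c) := by
      have gen : ∀ e, (T.tw q2 sw).matOf e = T.matOf ((colPerm n q2 sw).symm e) :=
        fun _ => rfl
      rw [gen, Equiv.symm_apply_apply]
    refine this.trans ?_
    funext i j
    unfold matOf
    rw [h2, h3]
  · have key : ∃ κ : Equiv.Perm ℕ, ∀ c : TabCell n, (c.1 = q1 ∨ c.1 = q2) →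
        (((T.chi ⟨i0, x⟩ ⟨i0, y⟩).trans (colPerm n q2 sw) c).2 : ℕ) = κ c.2 := by
      by_cases hh : h = q2
      · subst hh
        refine ⟨1, fun c hc => ?_⟩
        have hsw' : sw = Equiv.swap p p' := by
          rw [hsw]; simp [toQ2]
        rw [Equiv.trans_apply, chi_in c hc, hsw']
        by_cases h2 : c.1 = h
        · obtain ⟨j, z⟩ := c
          simp only at h2
          subst h2
          rw [colPerm_same, colPerm_same]
          simp
        · rw [colPerm_ne _ _ _ h2, colPerm_ne _ _ _ h2]; rfl
      · have hh1 : h = q1 := ha.resolve_right hh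
        subst hh1
        refine ⟨Equiv.swap (p : ℕ) (p' : ℕ), fun c hc => ?_⟩
        have hsw' : sw = Equiv.swap (Fin.cast hn p) (Fin.cast hn p') := by
          rw [hsw]; simp [toQ2, hq]
        rw [Equiv.trans_apply, chi_in c hc, hsw']
        rcases hc with h2 | h2
        · obtain ⟨j, z⟩ := c
          simp only at h2
          subst h2
          rw [colPerm_same, colPerm_ne _ _ _ hq]
          simp only [Equiv.swap_apply_def, Fin.ext_iff]
          split_ifs <;> rfl
        · have h3 : c.1 ≠ h := by rw [h2]; exact hq.symm
          rw [colPerm_ne _ _ _ h3]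
          obtain ⟨j, z⟩ := c
          simp only at h2
          subst h2
          rw [colPerm_same]
          simp only [Equiv.swap_apply_def, Fin.ext_iff, Fin.val_cast]
          split_ifs <;> rfl
    obtain ⟨κ, hκ⟩ := key
    intro c d hc hd
    rw [hκ c hc, hκ d hd]
    exact κ.injective.eq_iff
  · intro c c1 c2
    rw [swap_cell, Equiv.trans_apply, colPerm_ne, hchi, Equiv.Perm.mul_apply,
      colPerm_ne h]
    · rcases ha with e | e
      · intro e'; exact c1 (e'.trans e)
      · intro e'; exact c2 (e'.trans e)
    · rw [hcolchi]; exact c2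
  · intro e
    apply hpp
    have hv : ∀ (z : Fin (n h)) (hz : (⟨h, z⟩ : TabCell n).1 = q1 ∨ (⟨h, z⟩ : TabCell n).1 = q2),
        ((toQ2 hn ⟨h, z⟩ hz : Fin (n q2)) : ℕ) = z := by
      intro z hz
      unfold toQ2
      split_ifs <;> rfl
    have := congrArg Fin.val e
    rw [hv, hv] at this
    exact Fin.ext this

theorem tilde_neg {q1 q2 : ι} (hq : q1 ≠ q2) (hn : n q1 = n q2)
    (T1 T2 : TabSub A ι n s) (ψ : Equiv.Perm (TabCell n)) (hψ : Iso q1 q2 T1 T2 ψ)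
    (a b : TabCell n) (hab : a ≠ b) (htail : a.1 = b.1) (htailq : a.1 ≠ q1 ∧ a.1 ≠ q2)
    (hout : ∀ c, c.1 ≠ q1 → c.1 ≠ q2 → ψ c = Equiv.swap a b c)
    (R1 R2 : Finset (List (TabCell n))) (hR1 : T1.OpenReps q1 q2 R1)
    (hR2 : T2.OpenReps q1 q2 R2) {t1 t2 : ℕ}
    (D1 : TabSub A {i : ι // i ≠ q1 ∧ i ≠ q2} (fun i => n i.1) t1)
    (D2 : TabSub A {i : ι // i ≠ q1 ∧ i ≠ q2} (fun i => n i.1) t2)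
    (hD1 : T1.IsTilde q1 q2 R1 D1) (hD2 : T2.IsTilde q1 q2 R2 D2) :
    D2.bpf0 = - D1.bpf0 := by
  obtain ⟨i0, x⟩ := a
  obtain ⟨i0', y⟩ := b
  simp only at htail htailq
  subst htail
  have hxy : x ≠ y := fun e => hab (by rw [e])
  set θ := colPerm (fun i : {i : ι // i ≠ q1 ∧ i ≠ q2} => n i.1) ⟨i0, htailq⟩
    (Equiv.swap x y) with hθ
  have hemb : ∀ c', embCell q1 q2 (θ c') = ψ (embCell q1 q2 c') := by
    intro c'
    rw [hout _ c'.1.2.1 c'.1.2.2, swap_cell]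
    by_cases h : c'.1 = ⟨i0, htailq⟩
    · obtain ⟨j, z⟩ := c'
      simp only at h
      subst h
      rw [hθ, colPerm_same]
      exact (colPerm_same i0 _ z).symm
    · rw [hθ, colPerm_ne _ _ _ h, colPerm_ne]
      intro e
      exact h (Subtype.ext e)
  have hboth : ∀ c', D2.mate (θ c') = θ (D1.mate c') ∧
      ∀ i j, i < dimBound n → j < dimBound n → D2.matOf (θ c') i j = D1.matOf c' i j := by
    intro c'
    by_cases hm : (T1.mate (embCell q1 q2 c')).1 ≠ q1 ∧ (T1.mate (embCell q1 q2 c')).1 ≠ q2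
    · obtain ⟨-, k2, k3⟩ := hD1.1 c' hm
      have e : T2.mate (embCell q1 q2 (θ c')) = ψ (T1.mate (embCell q1 q2 c')) := by
        rw [hemb, hψ.mate]
      have hm2 : (T2.mate (embCell q1 q2 (θ c'))).1 ≠ q1 ∧
          (T2.mate (embCell q1 q2 (θ c'))).1 ≠ q2 := by
        rw [e, hψ.col]; exact hm
      obtain ⟨-, l2, l3⟩ := hD2.1 (θ c') hm2
      constructor
      · apply embCell_inj q1 q2
        rw [l2, e, hemb, k2]
      · intro i j _ _
        rw [l3, k3, hemb, hψ.mat]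
    · have hm' : (T1.mate (embCell q1 q2 c')).1 = q1 ∨ (T1.mate (embCell q1 q2 c')).1 = q2 := by
        by_contra h; push Not at h; exact hm h
      obtain ⟨l, hl, h0, hh⟩ := exists_open T1 hq hn (embCell q1 q2 c') c'.1.2 hm'
      obtain ⟨k2, k3⟩ := tilde_char T1 R1 hR1 D1 hD1 l hl h0 c' hh
      have h0' : l.map ψ ≠ [] := by simpa using h0
      obtain ⟨l2, l3⟩ := tilde_char T2 R2 hR2 D2 hD2 (l.map ψ) (hψ.isOpen hl) h0' (θ c')
        (by rw [List.head_map, hh, hemb])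
      constructor
      · apply embCell_inj q1 q2
        rw [l2, hemb, k2, List.getLast_map, hψ.mate]
      · intro i j hi hj
        rw [l3 i j hi hj, k3 i j hi hj, hψ.pathMat_map]
  refine bpf0_neg D1 D2 ⟨i0, htailq⟩ x y hxy (fun c => (hboth c).1) ?_
  intro c i j hi hj
  exact (hboth c).2 i j (hi.trans_le (le_dimBound (n := n) c.1.1))
    (hj.trans_le (le_dimBound (n := n) (D1.mate c).1.1))

end TabSub

open TabSub in
/-- With `g(T,τ) = sgn(τ)·bpf⁰_{T̃^τ}(X_{T̃^τ})·tr(T^τ_cl)`: if `a, b ∈t T^τ`, `a ≠ b`,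
`φ(a) = φ(b)`, `a' = b' ∈ {q_1,q_2}` and `a'' = b'' ∉ {q_1,q_2}`, then
`g(T, ('a,'b)∘τ) = g(T,τ)`. -/
theorem stmt17 (m s : ℕ) (n : Fin (m + 2) → ℕ)
    -- the distinguished columns are the last two: `q1 = m−1`, `q2 = m` (1-based)
    (q1 q2 : Fin (m + 2)) (hq1 : q1 = ⟨m, by omega⟩) (hq2 : q2 = ⟨m + 1, by omega⟩)
    (hn : n q1 = n q2)
    (T : TabSub ℚ (Fin (m + 2)) n s)
    (Ro Rcl : Equiv.Perm (Fin (n q2)) → Finset (List (TabCell n)))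
    (hRo : ∀ τ, (T.tw q2 τ).OpenReps q1 q2 (Ro τ))
    (hRcl : ∀ τ, (T.tw q2 τ).ClosedReps q1 q2 (Rcl τ))
    (D : ∀ τ : Equiv.Perm (Fin (n q2)),
      (t : ℕ) × TabSub ℚ {i : Fin (m + 2) // i ≠ q1 ∧ i ≠ q2} (fun i => n i.1) t)
    (hD : ∀ τ, IsTilde (T.tw q2 τ) q1 q2 (Ro τ) (D τ).2)
    -- `g(T,·)`
    (g : Equiv.Perm (Fin (n q2)) → ℚ)
    (hg : ∀ τ, g τ = (Equiv.Perm.sign τ : ℤ) •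
      ((D τ).2.bpf0 * trClosed (T.tw q2 τ) (Rcl τ)))
    (τ : Equiv.Perm (Fin (n q2)))
    (a b : TabCell n) (hab : a ≠ b)
    -- `φ(a) = φ(b)` in `T^τ`
    (hφ : (T.tw q2 τ).letter a = (T.tw q2 τ).letter b)
    -- `a'' = b'' ∉ {q_1,q_2}`
    (htail : a.1 = b.1) (htailq : a.1 ≠ q1 ∧ a.1 ≠ q2)
    -- `a' = b' ∈ {q_1,q_2}`
    (hhead : ((T.tw q2 τ).mate a).1 = ((T.tw q2 τ).mate b).1)
    (hheadq : ((T.tw q2 τ).mate a).1 = q1 ∨ ((T.tw q2 τ).mate a).1 = q2)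
    (hheadqb : ((T.tw q2 τ).mate b).1 = q1 ∨ ((T.tw q2 τ).mate b).1 = q2) :
    g (Equiv.swap (toQ2 hn ((T.tw q2 τ).mate a) hheadq)
        (toQ2 hn ((T.tw q2 τ).mate b) hheadqb) * τ) = g τ := by

  have hq : q1 ≠ q2 := by rw [hq1, hq2]; simp
  obtain ⟨ψ, hψ, hout, hne⟩ := tw_iso_aux (T.tw q2 τ) hq hn a b hab hφ htail htailq _ _
    rfl rfl hhead hheadq hheadqb
  rw [hg, hg, Equiv.Perm.sign_mul, Equiv.Perm.sign_swap hne]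
  have hD2 := hD (Equiv.swap (toQ2 hn ((T.tw q2 τ).mate a) hheadq)
        (toQ2 hn ((T.tw q2 τ).mate b) hheadqb) * τ)
  have hRo2 := hRo (Equiv.swap (toQ2 hn ((T.tw q2 τ).mate a) hheadq)
        (toQ2 hn ((T.tw q2 τ).mate b) hheadqb) * τ)
  have hRcl2 := hRcl (Equiv.swap (toQ2 hn ((T.tw q2 τ).mate a) hheadq)
        (toQ2 hn ((T.tw q2 τ).mate b) hheadqb) * τ)
  rw [← tw_mul] at hψ
  rw [hψ.trClosed _ _ (hRcl τ) hRcl2,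
    tilde_neg hq hn _ _ ψ hψ a b hab htail htailq hout _ _ (hRo τ) hRo2 _ _ (hD τ) hD2]
  simp
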